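/- Let λ ∈ ℝ and t₁ ∈ ℕ. Assume system (1.1) has a recessive solution Y₀ = (U₀; V₀) with U₀(t₁) invertible, and that (1.1) has the unique two point property on [t₁,∞) ∩ ℕ (whenever two vector solutions of (1.1) have equal u-components at two points t₁ ≤ s₁ < s₂, they coincide identically). Then for each integer s > t₁ there exists a unique matrix solution Y(·,s) = (U(·,s); V(·,s)) of (1.1) with U(t₁,s) = I_n and U(s,s) = 0, and for every t ∈ ℕ one has Y(t,s) → Y₀(t)U₀^{−1}(t₁) as s → ∞. -/

import Mathlib

open Matrix Filter
open scoped ComplexOrder Topology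

noncomputable section

/-- The canonical symplectic matrix `J = [[0, -I], [I, 0]]`. -/
def Jmat (n : ℕ) : Matrix (Fin n ⊕ Fin n) (Fin n ⊕ Fin n) ℂ :=
  Matrix.fromBlocks 0 (-1) 1 0

/-- The `2n × n` matrix `Y(t) = (U(t); V(t))`. -/
def Ymat {n : ℕ} (U V : ℕ → Matrix (Fin n) (Fin n) ℂ) (t : ℕ) :
    Matrix (Fin n ⊕ Fin n) (Fin n) ℂ :=
  Matrix.of (Sum.elim (fun i j => U t i j) (fun i j => V t i j))

/-- `y = (u; v)` is a (vector) solution of (1.1). -/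
def IsSol {n : ℕ} (A B C W : ℕ → Matrix (Fin n) (Fin n) ℂ) (lam : ℂ)
    (u v : ℕ → Fin n → ℂ) : Prop :=
  ∀ t : ℕ,
    u (t + 1) - u t = A t *ᵥ u (t + 1) + B t *ᵥ v t ∧
    v (t + 1) - v t = (C t - lam • W t) *ᵥ u (t + 1) - (A t)ᴴ *ᵥ v t

/-- `Y = (U; V)` is a matrix solution of (1.1). -/
def IsMatSol {n : ℕ} (A B C W : ℕ → Matrix (Fin n) (Fin n) ℂ) (lam : ℂ)
    (U V : ℕ → Matrix (Fin n) (Fin n) ℂ) : Prop :=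
  ∀ t : ℕ,
    U (t + 1) - U t = A t * U (t + 1) + B t * V t ∧
    V (t + 1) - V t = (C t - lam • W t) * U (t + 1) - (A t)ᴴ * V t

/-- A matrix solution is prepared (conjoined) if `Y*(t) J Y(t) = 0` for all `t`. -/
def IsPrepared {n : ℕ} (U V : ℕ → Matrix (Fin n) (Fin n) ℂ) : Prop :=
  ∀ t : ℕ, (Ymat U V t)ᴴ * Jmat n * Ymat U V t = 0

/-- `Y = (U; V)` is a recessive (principal) solution of (1.1). -/
def IsRecessive {n : ℕ} (A B C W : ℕ → Matrix (Fin n) (Fin n) ℂ) (lam : ℂ)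
    (U V : ℕ → Matrix (Fin n) (Fin n) ℂ) : Prop :=
  IsMatSol A B C W lam U V ∧ IsPrepared U V ∧
  ∀ U₁ V₁ : ℕ → Matrix (Fin n) (Fin n) ℂ, IsMatSol A B C W lam U₁ V₁ →
    (∃ Cm : Matrix (Fin n) (Fin n) ℂ, IsUnit Cm ∧
      ∀ t : ℕ, (Ymat U V t)ᴴ * Jmat n * Ymat U₁ V₁ t = Cm) →
    ∃ t₁ : ℕ, (∀ t, t₁ ≤ t → IsUnit (U₁ t)) ∧
      Tendsto (fun t => (U₁ t)⁻¹ * U t) atTop (nhds 0)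

section HamiltonianSystem

variable {n : ℕ} {A B C W : ℕ → Matrix (Fin n) (Fin n) ℂ} {lam : ℂ}

theorem IsMatSol.mul_right {U V : ℕ → Matrix (Fin n) (Fin n) ℂ}
    (h : IsMatSol A B C W lam U V) (K : Matrix (Fin n) (Fin n) ℂ) :
    IsMatSol A B C W lam (fun t => U t * K) (fun t => V t * K) := fun t => by
  obtain ⟨h₁, h₂⟩ := h t
  constructor
  · simp only [← Matrix.sub_mul, h₁, Matrix.add_mul, Matrix.mul_assoc]
  · simp only [← Matrix.sub_mul, h₂, ← Matrix.mul_assoc]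

theorem IsMatSol.sub {U V U' V' : ℕ → Matrix (Fin n) (Fin n) ℂ}
    (h : IsMatSol A B C W lam U V) (h' : IsMatSol A B C W lam U' V') :
    IsMatSol A B C W lam (fun t => U t - U' t) (fun t => V t - V' t) := fun t => by
  obtain ⟨h₁, h₂⟩ := h t
  obtain ⟨h₁', h₂'⟩ := h' t
  constructor
  · rw [sub_sub_sub_comm, h₁, h₁']
    noncomm_ring
  · rw [sub_sub_sub_comm, h₂, h₂', Matrix.mul_sub, Matrix.mul_sub]
    abel

theorem IsMatSol.mulVec {U V : ℕ → Matrix (Fin n) (Fin n) ℂ}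
    (h : IsMatSol A B C W lam U V) (x : Fin n → ℂ) :
    IsSol A B C W lam (fun t => U t *ᵥ x) (fun t => V t *ᵥ x) := fun t => by
  obtain ⟨h₁, h₂⟩ := h t
  constructor
  · simp only [← Matrix.sub_mulVec, h₁, Matrix.add_mulVec, Matrix.mulVec_mulVec]
  · rw [← Matrix.sub_mulVec, h₂, Matrix.sub_mulVec, Matrix.mulVec_mulVec, Matrix.mulVec_mulVec]

theorem isSol_zero : IsSol A B C W lam (fun _ => 0) (fun _ => 0) := fun t => by simp

theorem isMatSol_iff {U V : ℕ → Matrix (Fin n) (Fin n) ℂ} :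
    IsMatSol A B C W lam U V ↔ ∀ t,
      (1 - A t) * U (t + 1) = U t + B t * V t ∧
      V (t + 1) = (C t - lam • W t) * U (t + 1) + (1 - A t)ᴴ * V t := by
  refine forall_congr' fun t => and_congr ?_ ?_
  · rw [Matrix.sub_mul, Matrix.one_mul, sub_eq_iff_eq_add, sub_eq_iff_eq_add, add_assoc,
      add_comm (A t * _), add_comm (B t * V t)]
  · rw [conjTranspose_sub, conjTranspose_one, Matrix.sub_mul 1, Matrix.one_mul,
      sub_eq_iff_eq_add]
    constructor <;> intro h <;> rw [h] <;> abel

/-- The initial value problem for (1.1) at any time is solvable. -/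
theorem exists_isMatSol (hA : ∀ t, IsUnit (1 - A t)) (t₀ : ℕ)
    (X Y : Matrix (Fin n) (Fin n) ℂ) :
    ∃ U V, IsMatSol A B C W lam U V ∧ U t₀ = X ∧ V t₀ = Y := by
  have hdet (t : ℕ) : IsUnit (1 - A t).det := (isUnit_iff_isUnit_det _).1 (hA t)
  have hdetH (t : ℕ) : IsUnit (1 - A t)ᴴ.det :=
    (isUnit_iff_isUnit_det _).1 ((isUnit_conjTranspose _).2 (hA t))
  induction t₀ generalizing X Y with
  | zero =>
    let step (t : ℕ) (p : Matrix (Fin n) (Fin n) ℂ × Matrix (Fin n) (Fin n) ℂ) :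
        Matrix (Fin n) (Fin n) ℂ × Matrix (Fin n) (Fin n) ℂ :=
      ((1 - A t)⁻¹ * (p.1 + B t * p.2),
        (C t - lam • W t) * ((1 - A t)⁻¹ * (p.1 + B t * p.2)) + (1 - A t)ᴴ * p.2)
    let sol (t : ℕ) : Matrix (Fin n) (Fin n) ℂ × Matrix (Fin n) (Fin n) ℂ :=
      Nat.rec (X, Y) step t
    refine ⟨fun t => (sol t).1, fun t => (sol t).2, isMatSol_iff.2 fun t => ⟨?_, rfl⟩, rfl, rfl⟩
    exact mul_nonsing_inv_cancel_left _ _ (hdet t)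
  | succ t ih =>
    let Y' := ((1 - A t)ᴴ)⁻¹ * (Y - (C t - lam • W t) * X)
    obtain ⟨U, V, h, hU, hV⟩ := ih ((1 - A t) * X - B t * Y') Y'
    obtain ⟨h₁, h₂⟩ := isMatSol_iff.1 h t
    rw [hU, hV, sub_add_cancel] at h₁
    have hX : U (t + 1) = X := by
      simpa [nonsing_inv_mul_cancel_left _ _ (hdet t)] using congrArg ((1 - A t)⁻¹ * ·) h₁
    refine ⟨U, V, h, hX, ?_⟩
    rw [h₂, hX, hV, mul_nonsing_inv_cancel_left _ _ (hdetH t), add_sub_cancel]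

theorem Ymat_wronskian (U V U' V' : ℕ → Matrix (Fin n) (Fin n) ℂ) (t : ℕ) :
    (Ymat U V t)ᴴ * Jmat n * Ymat U' V' t = (V t)ᴴ * U' t - (U t)ᴴ * V' t := by
  have h (U V : ℕ → Matrix (Fin n) (Fin n) ℂ) : Ymat U V t = fromRows (U t) (V t) := rfl
  rw [h, h, Jmat, conjTranspose_fromRows_eq_fromCols_conjTranspose, fromCols_mul_fromBlocks,
    fromCols_mul_fromRows]
  simp [sub_eq_add_neg]

/-- For real `lam` the Wronskian of two matrix solutions is constant. -/
theorem IsMatSol.wronskian_eq {lam : ℝ} (hB : ∀ t, (B t).IsHermitian)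
    (hC : ∀ t, (C t).IsHermitian) (hW : ∀ t, (W t).IsHermitian)
    {U V U' V' : ℕ → Matrix (Fin n) (Fin n) ℂ}
    (h : IsMatSol A B C W lam U V) (h' : IsMatSol A B C W lam U' V') (s t : ℕ) :
    (V s)ᴴ * U' s - (U s)ᴴ * V' s = (V t)ᴴ * U' t - (U t)ᴴ * V' t := by
  suffices hstep : ∀ t, (V t)ᴴ * U' t - (U t)ᴴ * V' t = (V 0)ᴴ * U' 0 - (U 0)ᴴ * V' 0 by
    rw [hstep s, hstep t]
  intro t
  induction t with
  | zero => rfl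
  | succ t ih =>
    rw [← ih]
    obtain ⟨h₁, h₂⟩ := isMatSol_iff.1 h t
    obtain ⟨h₁', h₂'⟩ := isMatSol_iff.1 h' t
    have hD : (C t - (lam : ℂ) • W t)ᴴ = C t - (lam : ℂ) • W t := by
      simp [conjTranspose_sub, conjTranspose_smul, (hC t).eq, (hW t).eq]
    have h₃ := congrArg conjTranspose h₁
    rw [conjTranspose_mul, conjTranspose_add, conjTranspose_mul, (hB t).eq] at h₃
    rw [h₂, h₂', conjTranspose_add, conjTranspose_mul, conjTranspose_mul, hD,
      conjTranspose_conjTranspose, Matrix.add_mul, Matrix.mul_add, Matrix.mul_assoc _ (1 - A t),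
      h₁', ← Matrix.mul_assoc _ (1 - A t)ᴴ, h₃]
    noncomm_ring

theorem IsMatSol.eq_of_two_point {t₁ : ℕ}
    (hutp : ∀ u₁ v₁ u₂ v₂ : ℕ → Fin n → ℂ,
      IsSol A B C W lam u₁ v₁ → IsSol A B C W lam u₂ v₂ →
      ∀ s₁ s₂ : ℕ, t₁ ≤ s₁ → s₁ < s₂ →
        u₁ s₁ = u₂ s₁ → u₁ s₂ = u₂ s₂ →
        ∀ t : ℕ, u₁ t = u₂ t ∧ v₁ t = v₂ t)
    {U V U' V' : ℕ → Matrix (Fin n) (Fin n) ℂ}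
    (h : IsMatSol A B C W lam U V) (h' : IsMatSol A B C W lam U' V') {s : ℕ} (hs : t₁ < s)
    (h₁ : U t₁ = U' t₁) (h₂ : U s = U' s) : U = U' ∧ V = V' := by
  have key (x : Fin n → ℂ) := hutp _ _ _ _ (h.mulVec x) (h'.mulVec x) t₁ s le_rfl hs
    (by rw [h₁]) (by rw [h₂])
  exact ⟨funext fun t => mulVec_injective (funext fun x => (key x t).1),
    funext fun t => mulVec_injective (funext fun x => (key x t).2)⟩

theorem IsMatSol.isUnit_of_two_point {t₁ : ℕ}
    (hutp : ∀ u₁ v₁ u₂ v₂ : ℕ → Fin n → ℂ,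
      IsSol A B C W lam u₁ v₁ → IsSol A B C W lam u₂ v₂ →
      ∀ s₁ s₂ : ℕ, t₁ ≤ s₁ → s₁ < s₂ →
        u₁ s₁ = u₂ s₁ → u₁ s₂ = u₂ s₂ →
        ∀ t : ℕ, u₁ t = u₂ t ∧ v₁ t = v₂ t)
    {U V : ℕ → Matrix (Fin n) (Fin n) ℂ}
    (h : IsMatSol A B C W lam U V) (hU : U t₁ = 0) (hV : IsUnit (V t₁)) {s : ℕ} (hs : t₁ < s) :
    IsUnit (U s) := by
  rw [← mulVec_injective_iff_isUnit] at hV ⊢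
  refine (injective_iff_map_eq_zero (U s).mulVecLin).2 fun x hx => hV ?_
  simpa using (hutp _ _ _ _ (h.mulVec x) isSol_zero t₁ s le_rfl hs (by simp [hU]) hx t₁).2

end HamiltonianSystem

/-- assume (1.1) has a recessive solution `Y₀ = (U₀; V₀)` with
`U₀(t₁)` invertible and the unique two point property on `[t₁, ∞)`. Then for
each `s > t₁` there is a unique matrix solution `Y(⋅,s)` of (1.1) with
`U(t₁,s) = I` and `U(s,s) = 0`, and `Y(t,s) → Y₀(t)U₀⁻¹(t₁)` as `s → ∞` for
every `t`. -/
theorem recessive_as_limit (n : ℕ) (hn : 0 < n)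
    (A B C W : ℕ → Matrix (Fin n) (Fin n) ℂ)
    (hA : ∀ t, IsUnit (1 - A t))
    (hB : ∀ t, (B t).PosSemidef)
    (hC : ∀ t, (C t).IsHermitian)
    (hW : ∀ t, (W t).PosSemidef)
    (lam : ℝ) (t₁ : ℕ)
    (U₀ V₀ : ℕ → Matrix (Fin n) (Fin n) ℂ)
    (hrec : IsRecessive A B C W (lam : ℂ) U₀ V₀)
    (hU₀t₁ : IsUnit (U₀ t₁))
    -- unique two point property on `[t₁, ∞) ∩ ℕ`
    (hutp : ∀ u₁ v₁ u₂ v₂ : ℕ → Fin n → ℂ,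
      IsSol A B C W (lam : ℂ) u₁ v₁ → IsSol A B C W (lam : ℂ) u₂ v₂ →
      ∀ s₁ s₂ : ℕ, t₁ ≤ s₁ → s₁ < s₂ →
        u₁ s₁ = u₂ s₁ → u₁ s₂ = u₂ s₂ →
        ∀ t : ℕ, u₁ t = u₂ t ∧ v₁ t = v₂ t) :
    -- existence and uniqueness of `Y(⋅, s)`
    (∀ s : ℕ, t₁ < s →
      ∃! YV : (ℕ → Matrix (Fin n) (Fin n) ℂ) × (ℕ → Matrix (Fin n) (Fin n) ℂ),
        IsMatSol A B C W (lam : ℂ) YV.1 YV.2 ∧ YV.1 t₁ = 1 ∧ YV.1 s = 0) ∧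
    -- convergence `Y(t,s) → Y₀(t) U₀⁻¹(t₁)` as `s → ∞`
    (∀ Us Vs : ℕ → ℕ → Matrix (Fin n) (Fin n) ℂ,
      (∀ s : ℕ, t₁ < s →
        IsMatSol A B C W (lam : ℂ) (Us s) (Vs s) ∧ Us s t₁ = 1 ∧ Us s s = 0) →
      ∀ t : ℕ,
        Tendsto (fun s => Us s t) atTop (nhds (U₀ t * (U₀ t₁)⁻¹)) ∧
        Tendsto (fun s => Vs s t) atTop (nhds (V₀ t * (U₀ t₁)⁻¹))) := by
  obtain ⟨h₀, -, hlim⟩ := hrec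
  have hdet₀ : IsUnit (U₀ t₁).det := (isUnit_iff_isUnit_det _).1 hU₀t₁
  obtain ⟨Z, Q, hZ, hZt₁, hQt₁⟩ := exists_isMatSol (B := B) (C := C) (W := W)
    (lam := (lam : ℂ)) hA t₁ 0 1
  have hZunit {s : ℕ} (hs : t₁ < s) : IsUnit (Z s).det :=
    (isUnit_iff_isUnit_det _).1
      (hZ.isUnit_of_two_point hutp hZt₁ (by rw [hQt₁]; exact isUnit_one) hs)
  obtain ⟨-, -, hZlim⟩ := hlim Z Q hZ ⟨-(U₀ t₁)ᴴ, ((isUnit_conjTranspose _).2 hU₀t₁).neg,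
    fun t => by
      rw [Ymat_wronskian, h₀.wronskian_eq (fun t => (hB t).isHermitian) hC
        (fun t => (hW t).isHermitian) hZ t t₁, hZt₁, hQt₁]
      simp⟩
  have hsol (s : ℕ) := (h₀.sub (hZ.mul_right ((Z s)⁻¹ * U₀ s))).mul_right (U₀ t₁)⁻¹
  have hone (s : ℕ) : (U₀ t₁ - Z t₁ * ((Z s)⁻¹ * U₀ s)) * (U₀ t₁)⁻¹ = 1 := by
    rw [hZt₁, Matrix.zero_mul, sub_zero, mul_nonsing_inv _ hdet₀]
  have hzero {s : ℕ} (hs : t₁ < s) : (U₀ s - Z s * ((Z s)⁻¹ * U₀ s)) * (U₀ t₁)⁻¹ = 0 := by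
    rw [mul_nonsing_inv_cancel_left _ _ (hZunit hs), sub_self, Matrix.zero_mul]
  have hconv (X P : Matrix (Fin n) (Fin n) ℂ) :
      Tendsto (fun s => (X - P * ((Z s)⁻¹ * U₀ s)) * (U₀ t₁)⁻¹) atTop
        (nhds (X * (U₀ t₁)⁻¹)) := by
    simpa using ((tendsto_const_nhds (x := X)).sub
      ((tendsto_const_nhds (x := P)).mul hZlim)).mul_const (U₀ t₁)⁻¹
  refine ⟨fun s hs => ⟨(_, _), ⟨hsol s, hone s, hzero hs⟩, ?_⟩, fun Us Vs hY t => ?_⟩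
  · rintro ⟨U, V⟩ ⟨h, h₁, h₂⟩
    obtain ⟨hU, hV⟩ := h.eq_of_two_point hutp (hsol s) hs (h₁.trans (hone s).symm)
      (h₂.trans (hzero hs).symm)
    exact Prod.ext hU hV
  · have hev : ∀ᶠ s in atTop,
        (U₀ t - Z t * ((Z s)⁻¹ * U₀ s)) * (U₀ t₁)⁻¹ = Us s t ∧
        (V₀ t - Q t * ((Z s)⁻¹ * U₀ s)) * (U₀ t₁)⁻¹ = Vs s t := by
      filter_upwards [eventually_gt_atTop t₁] with s hs
      obtain ⟨h, h₁, h₂⟩ := hY s hs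
      obtain ⟨hU, hV⟩ := (hsol s).eq_of_two_point hutp h hs ((hone s).trans h₁.symm)
        ((hzero hs).trans h₂.symm)
      exact ⟨congrFun hU t, congrFun hV t⟩
    exact ⟨(hconv _ _).congr' (hev.mono fun _ h => h.1),
      (hconv _ _).congr' (hev.mono fun _ h => h.2)⟩
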